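/- arXiv:0805.3277 — 2 statements merged into one kernel-verified Lean document; each statement's English description precedes it below -/
import Mathlib

section
/- Let G be a simple graph with n vertices and list chromatic number χ_ℓ, let 1 ≤ r ≤ χ_ℓ, and write χ_ℓ = k·r + r₀ with 0 ≤ r₀ < r. Then χ_ℓ·λ_r(G) ≥ r·n or χ_ℓ·λ_{r₀}(G) ≥ r₀·n. -/
open SimpleGraph

/-- `c` properly colors each vertex of `S` from its list `L`. -/
def IsPartialListColoring {V : Type*} (G : SimpleGraph V) (L : V → Finset ℕ)
    (S : Set V) (c : V → ℕ) : Prop :=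
  (∀ v ∈ S, c v ∈ L v) ∧ ∀ u ∈ S, ∀ v ∈ S, G.Adj u v → c u ≠ c v

/-- `λ_L(G)`: the maximum number of vertices properly colorable from the lists of `L`. -/
noncomputable def lamL {V : Type*} (G : SimpleGraph V) (L : V → Finset ℕ) : ℕ :=
  sSup {k | ∃ (S : Finset V) (c : V → ℕ), S.card = k ∧ IsPartialListColoring G L S c}

/-- `λ_t(G)`: the minimum of `λ_L(G)` over all `t`-list assignments `L`. -/
noncomputable def lam {V : Type*} (G : SimpleGraph V) (t : ℕ) : ℕ :=
  sInf {m | ∃ L : V → Finset ℕ, (∀ v, (L v).card = t) ∧ lamL G L = m}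

/-- `G` admits a full proper coloring from the lists of `L`. -/
def ListColorable {V : Type*} (G : SimpleGraph V) (L : V → Finset ℕ) : Prop :=
  ∃ c : V → ℕ, (∀ v, c v ∈ L v) ∧ ∀ u v, G.Adj u v → c u ≠ c v

/-- The list chromatic number of `G`. -/
noncomputable def listChromaticNumber {V : Type*} (G : SimpleGraph V) : ℕ :=
  sInf {k | ∀ L : V → Finset ℕ, (∀ v, (L v).card = k) → ListColorable G L}


lemma lamL_bdd {V : Type*} [Fintype V] (G : SimpleGraph V) (L : V → Finset ℕ) :
    BddAbove {k | ∃ (S : Finset V) (c : V → ℕ), S.card = k ∧ IsPartialListColoring G L S c} := by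
  refine ⟨Fintype.card V, ?_⟩
  rintro k ⟨S, c, rfl, -⟩
  exact Finset.card_le_univ S

lemma le_lamL {V : Type*} [Fintype V] (G : SimpleGraph V) (L : V → Finset ℕ)
    (S : Finset V) (c : V → ℕ) (h : IsPartialListColoring G L S c) : S.card ≤ lamL G L :=
  le_csSup (lamL_bdd G L) ⟨S, c, rfl, h⟩

lemma lamL_attained {V : Type*} [Fintype V] (G : SimpleGraph V) (L : V → Finset ℕ) :
    ∃ (S : Finset V) (c : V → ℕ), S.card = lamL G L ∧ IsPartialListColoring G L S c :=
  Nat.sSup_mem (s := {k | ∃ (S : Finset V) (c : V → ℕ), S.card = k ∧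
    IsPartialListColoring G L S c})
    ⟨0, ∅, fun _ => 0, by simp, by simp [IsPartialListColoring]⟩ (lamL_bdd G L)

lemma lam_attained {V : Type*} (G : SimpleGraph V) (t : ℕ) :
    ∃ L : V → Finset ℕ, (∀ v, (L v).card = t) ∧ lamL G L = lam G t :=
  Nat.sInf_mem (s := {m | ∃ L : V → Finset ℕ, (∀ v, (L v).card = t) ∧ lamL G L = m})
    ⟨_, fun _ => Finset.range t, by simp, rfl⟩

lemma lam_le {V : Type*} (G : SimpleGraph V) (t : ℕ) (L : V → Finset ℕ)
    (h : ∀ v, (L v).card = t) : lam G t ≤ lamL G L :=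
  Nat.sInf_le ⟨L, h, rfl⟩

/-- Subadditivity of `λ`: use disjoint color sets for the two extremal assignments. -/
lemma lam_add_le {V : Type*} [Fintype V] (G : SimpleGraph V) (s t : ℕ) :
    lam G (s + t) ≤ lam G s + lam G t := by
  classical
  obtain ⟨A, hA, hA'⟩ := lam_attained G s
  obtain ⟨B, hB, hB'⟩ := lam_attained G t
  set L : V → Finset ℕ := fun v =>
    (A v).image (fun x => 2 * x) ∪ (B v).image (fun x => 2 * x + 1) with hL
  have hcard : ∀ v, (L v).card = s + t := by
    intro v
    rw [hL]
    dsimp only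
    rw [Finset.card_union_of_disjoint, Finset.card_image_of_injective,
      Finset.card_image_of_injective, hA, hB]
    · intro a b h
      simp only at h
      omega
    · intro a b h
      simp only at h
      omega
    · rw [Finset.disjoint_left]
      intro x hx hy
      simp only [Finset.mem_image] at hx hy
      obtain ⟨a, -, rfl⟩ := hx
      obtain ⟨b, -, hb⟩ := hy
      omega
  refine (lam_le G _ L hcard).trans ?_
  obtain ⟨S, c, hS, hc1, hc2⟩ := lamL_attained G L
  rw [← hS, ← hA', ← hB', ← Finset.card_filter_add_card_filter_not (s := S) (fun v => c v % 2 = 0)]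
  refine Nat.add_le_add (le_lamL G A _ (fun v => c v / 2) ⟨?_, ?_⟩)
    (le_lamL G B _ (fun v => c v / 2) ⟨?_, ?_⟩)
  · intro v hv
    simp only [Finset.coe_filter, Set.mem_setOf_eq] at hv
    have := hc1 v hv.1
    simp only [hL, Finset.mem_union, Finset.mem_image] at this
    obtain ⟨a, ha, h⟩ | ⟨a, ha, h⟩ := this
    · have : c v / 2 = a := by omega
      simpa [this] using ha
    · omega
  · intro u hu v hv huv
    simp only [Finset.coe_filter, Set.mem_setOf_eq] at hu hv
    have := hc2 u hu.1 v hv.1 huv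
    dsimp only
    omega
  · intro v hv
    simp only [Finset.coe_filter, Set.mem_setOf_eq] at hv
    have := hc1 v hv.1
    simp only [hL, Finset.mem_union, Finset.mem_image] at this
    obtain ⟨a, ha, h⟩ | ⟨a, ha, h⟩ := this
    · omega
    · have : c v / 2 = a := by omega
      simpa [this] using ha
  · intro u hu v hv huv
    simp only [Finset.coe_filter, Set.mem_setOf_eq] at hu hv
    have := hc2 u hu.1 v hv.1 huv
    dsimp only
    omega

lemma lam_mul_add_le {V : Type*} [Fintype V] (G : SimpleGraph V) (k r s : ℕ) :
    lam G (k * r + s) ≤ k * lam G r + lam G s := by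
  induction k with
  | zero => simp
  | succ k ih =>
    have h := lam_add_le G r (k * r + s)
    have e : (k + 1) * r + s = r + (k * r + s) := by ring
    rw [e]
    linarith

lemma card_le_lam {V : Type*} [Fintype V] (G : SimpleGraph V)
    (h : 1 ≤ listChromaticNumber G) : Fintype.card V ≤ lam G (listChromaticNumber G) := by
  have hne : {k | ∀ L : V → Finset ℕ, (∀ v, (L v).card = k) → ListColorable G L}.Nonempty := by
    by_contra hcon
    rw [Set.not_nonempty_iff_eq_empty] at hcon
    rw [listChromaticNumber, hcon] at h
    simp at h
  have hmem := Nat.sInf_mem hne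
  obtain ⟨L, hL, hL'⟩ := lam_attained G (listChromaticNumber G)
  obtain ⟨c, hc1, hc2⟩ := hmem L hL
  rw [← hL']
  exact le_lamL G L Finset.univ c ⟨fun v _ => hc1 v, fun u _ v _ => hc2 u v⟩

theorem agh_conjecture_remainder {V : Type*} [Fintype V] (G : SimpleGraph V)
    (χ r k r₀ : ℕ) (hχ : listChromaticNumber G = χ) (hr : 1 ≤ r) (hrχ : r ≤ χ)
    (hdiv : χ = k * r + r₀) (hr₀ : r₀ < r) :
    r * Fintype.card V ≤ χ * lam G r ∨ r₀ * Fintype.card V ≤ χ * lam G r₀ := by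
  by_contra! hcon
  obtain ⟨h1, h2⟩ := hcon
  have hn := card_le_lam G (by omega)
  rw [hχ] at hn
  have hs := lam_mul_add_le G k r r₀
  rw [← hdiv] at hs
  have h3 : χ * Fintype.card V ≤ χ * (k * lam G r + lam G r₀) :=
    Nat.mul_le_mul_left _ (hn.trans hs)
  have h4 : k * (χ * lam G r) ≤ k * (r * Fintype.card V) := Nat.mul_le_mul_left _ h1.le
  have h5 : χ * Fintype.card V = k * (r * Fintype.card V) + r₀ * Fintype.card V := by
    rw [hdiv]; ring
  have h6 : χ * (k * lam G r + lam G r₀) = k * (χ * lam G r) + χ * lam G r₀ := by ring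
  omega
end

section
/- Let G be a simple graph with n vertices and chromatic number χ, and let 0 ≤ t. Then λ_t(G) ≥ (1 − (1 − 1/χ)^t)·n. -/
open SimpleGraph

lemma agh_exists_map {V : Type*} [Fintype V] (χ t : ℕ) (hpos : 0 < χ) (f : V → Fin χ)
    (L : V → Finset ℕ) (hL : ∀ v, (L v).card = t) :
    ∃ φ : ℕ → Fin χ, (1 - (1 - 1 / (χ : ℝ)) ^ t) * Fintype.card V ≤
      ((Finset.univ.filter (fun v => ∃ c ∈ L v, φ c = f v)).card : ℝ) := by
  classical
  obtain ⟨C, hC⟩ : ∃ C : Finset ℕ, ∀ v, L v ⊆ C :=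
    ⟨Finset.univ.biUnion L, fun v => Finset.subset_biUnion_of_mem L (Finset.mem_univ v)⟩
  have hχ0 : (χ : ℝ) ≠ 0 := by positivity
  -- number of bad maps for each vertex
  have hbad : ∀ v, ((Finset.univ.filter
      (fun φ : C → Fin χ => ∀ c : C, (c : ℕ) ∈ L v → φ c ≠ f v)).card : ℝ)
      = (1 - 1 / (χ : ℝ)) ^ t * (χ : ℝ) ^ C.card := by
    intro v
    have h1 : (Finset.univ.filter
      (fun φ : C → Fin χ => ∀ c : C, (c : ℕ) ∈ L v → φ c ≠ f v)) =
      Fintype.piFinset (fun c : C => if (c : ℕ) ∈ L v then Finset.univ.erase (f v)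
        else Finset.univ) := by
      ext φ
      simp only [Finset.mem_filter, Finset.mem_univ, true_and, Fintype.mem_piFinset]
      refine forall_congr' fun c => ?_
      by_cases h : (c : ℕ) ∈ L v <;> simp [h]
    rw [h1, Fintype.card_piFinset]
    push_cast
    have h2 : ∀ c : C, (((if (c : ℕ) ∈ L v then Finset.univ.erase (f v)
        else Finset.univ : Finset (Fin χ)).card : ℕ) : ℝ) =
        (if (c : ℕ) ∈ L v then (1 - 1 / (χ : ℝ)) else 1) * χ := by
      intro c
      by_cases h : (c : ℕ) ∈ L v
      · simp only [h, if_true]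
        rw [Finset.card_erase_of_mem (Finset.mem_univ _), Finset.card_univ, Fintype.card_fin,
          Nat.cast_sub hpos]
        field_simp
        simp
      · simp [h]
    rw [Finset.prod_congr rfl (fun c _ => h2 c), Finset.prod_mul_distrib]
    congr 1
    · rw [Finset.univ_eq_attach,
        Finset.prod_attach C (fun c => if c ∈ L v then (1 - 1 / (χ : ℝ)) else 1),
        Finset.prod_ite_mem, Finset.inter_eq_right.2 (hC v), Finset.prod_const, hL]
    · simp
  let bad : (C → Fin χ) → Finset V := fun φ =>
    Finset.univ.filter (fun v => ∀ c : C, (c : ℕ) ∈ L v → φ c ≠ f v)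
  have hsum : ∑ φ : C → Fin χ, ((bad φ).card : ℝ) =
      ∑ φ : C → Fin χ, (1 - 1 / (χ : ℝ)) ^ t * Fintype.card V := by
    have : ∑ φ : C → Fin χ, ((bad φ).card : ℝ) = ∑ v : V, ((Finset.univ.filter
      (fun φ : C → Fin χ => ∀ c : C, (c : ℕ) ∈ L v → φ c ≠ f v)).card : ℝ) := by
      simp only [bad, Finset.card_filter, Nat.cast_sum]
      exact Finset.sum_comm
    rw [this, Finset.sum_congr rfl (fun v _ => hbad v)]
    simp
    ring
  have : Nonempty (Fin χ) := ⟨⟨0, hpos⟩⟩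
  obtain ⟨φ, -, hφ⟩ := Finset.exists_le_of_sum_le (Finset.univ_nonempty) hsum.le
  refine ⟨fun c => if h : c ∈ C then φ ⟨c, h⟩ else ⟨0, hpos⟩, ?_⟩
  have hcompl : (Finset.univ : Finset V).card ≤ (bad φ).card + (Finset.univ.filter (fun v =>
      ∃ c ∈ L v, (if h : c ∈ C then φ ⟨c, h⟩ else ⟨0, hpos⟩) = f v)).card := by
    refine le_trans (Finset.card_le_card ?_) (Finset.card_union_le _ _)
    intro v _
    simp only [bad, Finset.mem_union, Finset.mem_filter, Finset.mem_univ, true_and]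
    by_contra! h
    obtain ⟨⟨c, hc, hcv⟩, h2⟩ := h
    have := h2 c hc
    simp only [c.2, dif_pos] at this
    exact this hcv
  rw [Finset.card_univ] at hcompl
  have : (Fintype.card V : ℝ) ≤ (bad φ).card + ((Finset.univ.filter (fun v =>
      ∃ c ∈ L v, (if h : c ∈ C then φ ⟨c, h⟩ else ⟨0, hpos⟩) = f v)).card : ℝ) := by
    exact_mod_cast hcompl
  linarith

theorem lam_ge_agh_bound {V : Type*} [Fintype V] (G : SimpleGraph V)
    (χ t : ℕ) (hχ : G.chromaticNumber = (χ : ℕ∞)) :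
    (1 - (1 - 1 / (χ : ℝ)) ^ t) * Fintype.card V ≤ (lam G t : ℝ) := by
  classical
  have hcol : G.Colorable χ := chromaticNumber_le_iff_colorable.1 hχ.le
  obtain ⟨f⟩ := hcol
  rcases Nat.eq_zero_or_pos χ with h0 | hpos
  · subst h0
    have : IsEmpty V := ⟨fun v => (f v).elim0⟩
    simp
  have hne : {m | ∃ L : V → Finset ℕ, (∀ v, (L v).card = t) ∧ lamL G L = m}.Nonempty :=
    ⟨_, fun _ => Finset.range t, by simp, rfl⟩
  obtain ⟨L, hL, hm⟩ := Nat.sInf_mem hne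
  change lamL G L = lam G t at hm
  rw [← hm]
  obtain ⟨φ, hφ⟩ := agh_exists_map χ t hpos f L hL
  refine hφ.trans ?_
  have hch : ∀ v, ∃ c, (∃ c ∈ L v, φ c = f v) → c ∈ L v ∧ φ c = f v := by
    intro v
    by_cases h : ∃ c ∈ L v, φ c = f v
    · obtain ⟨c, hc⟩ := h
      exact ⟨c, fun _ => hc⟩
    · exact ⟨0, fun h' => absurd h' h⟩
  choose c hc using hch
  norm_cast
  refine le_csSup ⟨Fintype.card V, ?_⟩ ⟨_, c, rfl, ?_, ?_⟩
  · rintro k ⟨S, _, rfl, _⟩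
    exact Finset.card_le_univ S
  · intro v hv
    exact (hc v (by simpa using hv)).1
  · intro u hu v hv huv he
    have h1 := (hc u (by simpa using hu)).2
    have h2 := (hc v (by simpa using hv)).2
    exact f.valid huv (by rw [← h1, ← h2, he])
end
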